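/- For all integers k ≥ 3 and j ≥ 0, there is no S-linear isomorphism φ : D_0(f_{j+1,k}) → D_0(f_{j,k}) such that for every integer d ≥ 0, φ maps every derivation in D_0(f_{j+1,k}) that is homogeneous of degree d+3 to a derivation homogeneous of degree d. (That is, the shift isomorphism T_{A} ≅ T_{B}(3), where A = A_{A2}^{[−j,k+j]}, B = A_{A2}^{[−j−1,k+j+1]} and 3 is the Coxeter number of A2, fails for every k ≥ 3.) -/

import Mathlib

open MvPolynomial

noncomputable section

abbrev S := MvPolynomial (Fin 3) ℝ

/-- The module of logarithmic derivations killing `f`. -/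
def D0 (f : S) : Submodule S (Derivation ℝ S S) where
  carrier := {θ | θ f = 0}
  add_mem' := by
    intro a b ha hb
    simp only [Set.mem_setOf_eq] at *
    simp [ha, hb]
  zero_mem' := by simp
  smul_mem' := by
    intro c θ hθ
    simp only [Set.mem_setOf_eq] at *
    simp [hθ]

def fjk (j k : ℕ) : S :=
  X 2 * ∏ s ∈ Finset.Icc (-(j : ℤ)) ((k : ℤ) + j),
    ((X 0 - C (s : ℝ) * X 2) * (X 1 - C (s : ℝ) * X 2) * (X 0 + X 1 - C (s : ℝ) * X 2))

/-- A derivation is homogeneous of degree `d` if its values on variables are. -/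
def IsHomogDer (θ : Derivation ℝ S S) (d : ℕ) : Prop :=
  ∀ i : Fin 3, (θ (X i)).IsHomogeneous d

/-! ### Univariate window lemmas -/

/-- Coefficients of `(1+t)^n c`. -/
def ec (n : ℕ) (l : ℕ) : Polynomial ℝ →ₗ[ℝ] ℝ :=
  (Polynomial.lcoeff ℝ l).comp (LinearMap.mulLeft ℝ ((1 + Polynomial.X : Polynomial ℝ) ^ n))

lemma ec_apply (n l : ℕ) (c : Polynomial ℝ) :
    ec n l c = (((1 + Polynomial.X : Polynomial ℝ) ^ n) * c).coeff l := rfl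

lemma window_le (n P w R : ℕ) (c : Polynomial ℝ) (hc : c ≠ 0) (hR : c.natDegree ≤ R)
    (hP : P ≤ n) (hw : ∀ l, P ≤ l → l < P + w → ec n l c = 0) : w ≤ R := by
  set E : Polynomial ℝ := ((1 + Polynomial.X : Polynomial ℝ) ^ n) * c with hE
  have h1m : (1 + Polynomial.X : Polynomial ℝ).Monic := by
    rw [add_comm]; exact Polynomial.monic_X_add_C (1 : ℝ)
  have h1d : (1 + Polynomial.X : Polynomial ℝ).natDegree = 1 := by
    rw [add_comm]; exact Polynomial.natDegree_X_add_C (1 : ℝ)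
  have hEdeg : E.natDegree = n + c.natDegree := by
    rw [hE, (h1m.pow n).natDegree_mul' hc, h1m.natDegree_pow, h1d, mul_one]
  have hE0 : E ≠ 0 := mul_ne_zero (h1m.pow n).ne_zero hc
  set F := Polynomial.derivative^[P] E with hF
  have hF0 : F ≠ 0 := by
    intro h
    have h2 : F.coeff (n + c.natDegree - P) = 0 := by rw [h]; simp
    rw [hF, Polynomial.coeff_iterate_derivative] at h2
    have h3 : n + c.natDegree - P + P = n + c.natDegree := by omega
    rw [h3, ← hEdeg, nsmul_eq_mul] at h2
    rcases mul_eq_zero.1 h2 with h4 | h4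
    · have : E.natDegree.descFactorial P = 0 := by exact_mod_cast h4
      rw [Nat.descFactorial_eq_zero_iff_lt] at this
      omega
    · exact hE0 (Polynomial.leadingCoeff_eq_zero.1 h4)
  have hd1 : (1 + Polynomial.X : Polynomial ℝ) ^ (n - P) ∣ F :=
    Polynomial.pow_sub_dvd_iterate_derivative_of_pow_dvd P (Dvd.intro _ rfl)
  have hd2 : (Polynomial.X : Polynomial ℝ) ^ w ∣ F := by
    rw [Polynomial.X_pow_dvd_iff]
    intro d hd
    rw [hF, Polynomial.coeff_iterate_derivative]
    have := hw (d + P) (by omega) (by omega)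
    rw [ec_apply] at this
    rw [hE, this, smul_zero]
  have hcop : IsCoprime ((1 + Polynomial.X : Polynomial ℝ) ^ (n - P)) (Polynomial.X ^ w) := by
    apply IsCoprime.pow
    exact ⟨1, -1, by ring⟩
  have hdvd := hcop.mul_dvd hd1 hd2
  have hle := Polynomial.natDegree_le_of_dvd hdvd hF0
  rw [(h1m.pow _).natDegree_mul' (pow_ne_zero _ Polynomial.X_ne_zero), h1m.natDegree_pow, h1d,
    Polynomial.natDegree_X_pow] at hle
  have h9 : F.natDegree ≤ E.natDegree - P := Polynomial.natDegree_iterate_derivative E P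
  omega

lemma window_exists (n P w R : ℕ) (h : w ≤ R) : ∃ c : Polynomial ℝ, c ≠ 0 ∧ c.natDegree ≤ R ∧
    ∀ l, P ≤ l → l < P + w → ec n l c = 0 := by
  let f : Polynomial.degreeLT ℝ (R + 1) →ₗ[ℝ] (Fin w → ℝ) :=
    (LinearMap.pi fun i : Fin w => ec n (P + i)).comp (Polynomial.degreeLT ℝ (R + 1)).subtype
  have : FiniteDimensional ℝ (Polynomial.degreeLT ℝ (R + 1)) :=
    (Polynomial.degreeLTEquiv ℝ (R + 1)).symm.finiteDimensional
  have hfr : Module.finrank ℝ (Polynomial.degreeLT ℝ (R + 1)) = R + 1 := by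
    rw [(Polynomial.degreeLTEquiv ℝ (R + 1)).finrank_eq]; simp
  have hk : LinearMap.ker f ≠ ⊥ := LinearMap.ker_ne_bot_of_finrank_lt (by
    rw [hfr]; simp; omega)
  obtain ⟨x, hx, hx0⟩ := (Submodule.ne_bot_iff _).1 hk
  refine ⟨x.1, fun h => hx0 (Subtype.ext h), ?_, ?_⟩
  · have := x.2
    rw [Polynomial.mem_degreeLT] at this
    by_cases h0 : x.1 = 0
    · simp [h0]
    · have := (Polynomial.natDegree_lt_iff_degree_lt h0).2 this
      omega
  · intro l h1 h2
    have := congrFun (LinearMap.mem_ker.1 hx) ⟨l - P, by omega⟩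
    simp only [f, LinearMap.comp_apply, LinearMap.pi_apply, Submodule.subtype_apply,
      Pi.zero_apply] at this
    rwa [Nat.add_sub_cancel' h1] at this

/-- degree at most `R`, and the window `[P, Q)` of coefficients of `(1+t)^n c` vanishes. -/
def Wn (n R P Q : ℕ) : Submodule ℝ (Polynomial ℝ) :=
  Polynomial.degreeLT ℝ (R + 1) ⊓ ⨅ l : Finset.Ico P Q, LinearMap.ker (ec n l)

lemma mem_Wn {n R P Q : ℕ} {c : Polynomial ℝ} : c ∈ Wn n R P Q ↔
    c.natDegree ≤ R ∧ ∀ l, P ≤ l → l < Q → ec n l c = 0 := by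
  unfold Wn
  rw [Submodule.mem_inf, Submodule.mem_iInf, Polynomial.mem_degreeLT]
  have : c.degree < ((R + 1 : ℕ) : WithBot ℕ) ↔ c.natDegree ≤ R := by
    by_cases h0 : c = 0
    · simp [h0]
    · rw [← Polynomial.natDegree_lt_iff_degree_lt h0]; omega
  rw [this]
  simp only [LinearMap.mem_ker, Subtype.forall, Finset.mem_Ico]
  constructor
  · rintro ⟨a, b⟩; exact ⟨a, fun l h1 h2 => b l ⟨h1, h2⟩⟩
  · rintro ⟨a, b⟩; exact ⟨a, fun l h => b l h.1 h.2⟩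

lemma finrank_Wn (n R P w : ℕ) : R + 1 ≤ Module.finrank ℝ (Wn n R P (P + w)) + w := by
  let f : Polynomial.degreeLT ℝ (R + 1) →ₗ[ℝ] (Fin w → ℝ) :=
    (LinearMap.pi fun i : Fin w => ec n (P + i)).comp (Polynomial.degreeLT ℝ (R + 1)).subtype
  have : FiniteDimensional ℝ (Polynomial.degreeLT ℝ (R + 1)) :=
    (Polynomial.degreeLTEquiv ℝ (R + 1)).symm.finiteDimensional
  have hfr : Module.finrank ℝ (Polynomial.degreeLT ℝ (R + 1)) = R + 1 := by
    rw [(Polynomial.degreeLTEquiv ℝ (R + 1)).finrank_eq]; simp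
  have h1 := LinearMap.finrank_range_add_finrank_ker f
  have h2 : Module.finrank ℝ (LinearMap.range f) ≤ w := by
    simpa using Submodule.finrank_le (LinearMap.range f)
  have : FiniteDimensional ℝ (Wn n R P (P + w)) :=
    Submodule.finiteDimensional_of_le (S₂ := Polynomial.degreeLT ℝ (R + 1)) inf_le_left
  let g : LinearMap.ker f →ₗ[ℝ] Wn n R P (P + w) :=
    LinearMap.codRestrict _ ((Polynomial.degreeLT ℝ (R + 1)).subtype.comp
      (LinearMap.ker f).subtype) (by
      intro x
      refine ⟨x.1.2, ?_⟩
      rw [SetLike.mem_coe, Submodule.mem_iInf]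
      rintro ⟨l, hl⟩
      rw [Finset.mem_Ico] at hl
      have := congrFun (LinearMap.mem_ker.1 x.2) ⟨l - P, by omega⟩
      simp only [f, LinearMap.comp_apply, LinearMap.pi_apply, Submodule.subtype_apply,
        Pi.zero_apply] at this
      rwa [Nat.add_sub_cancel' hl.1] at this)
  have h3 : Module.finrank ℝ (LinearMap.ker f) ≤ Module.finrank ℝ (Wn n R P (P + w)) := by
    apply LinearMap.finrank_le_finrank_of_injective (f := g)
    intro x y hxy
    have := congrArg Subtype.val hxy
    exact Subtype.ext (Subtype.ext this)
  omega

lemma ec_zero (n : ℕ) (c : Polynomial ℝ) : ec n 0 c = c.coeff 0 := by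
  rw [ec_apply, Polynomial.mul_coeff_zero]
  simp [Polynomial.coeff_zero_eq_eval_zero]

lemma ec_X_mul (n l : ℕ) (c : Polynomial ℝ) : ec n (l + 1) (Polynomial.X * c) = ec n l c := by
  rw [ec_apply, ec_apply, mul_left_comm, Polynomial.coeff_X_mul]

/-- The operator sending `c` to `t(1+t) dc - M t c`. -/
def TopOp (M : ℕ) (c : Polynomial ℝ) : Polynomial ℝ :=
  Polynomial.X * Polynomial.derivative c + Polynomial.X * (Polynomial.X * Polynomial.derivative c)
    - Polynomial.X * (Polynomial.C (M : ℝ) * c)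

lemma ec_TopOp (n M l : ℕ) (c : Polynomial ℝ) : ec n (l + 1) (TopOp M c) =
    ((l : ℝ) + 1) * ec n (l + 1) c + ((l : ℝ) - n - M) * ec n l c := by
  have key : (1 + Polynomial.X : Polynomial ℝ) ^ n * TopOp M c =
      Polynomial.X * (Polynomial.derivative ((1 + Polynomial.X : Polynomial ℝ) ^ n * c)
      + Polynomial.X * Polynomial.derivative ((1 + Polynomial.X : Polynomial ℝ) ^ n * c)
      - Polynomial.C ((n : ℝ) + M) * ((1 + Polynomial.X : Polynomial ℝ) ^ n * c)) := by
    unfold TopOp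
    rcases n with _ | n
    · simp; ring
    · simp only [Polynomial.derivative_mul, Polynomial.derivative_pow, Polynomial.derivative_add,
        Polynomial.derivative_one, Polynomial.derivative_X, Nat.add_sub_cancel, map_add,
        Polynomial.C_eq_natCast, map_natCast]
      push_cast
      ring
  rw [ec_apply, key, Polynomial.coeff_X_mul, ec_apply, ec_apply]
  generalize (1 + Polynomial.X : Polynomial ℝ) ^ n * c = E
  rw [Polynomial.coeff_sub, Polynomial.coeff_add, Polynomial.coeff_C_mul,
    Polynomial.coeff_derivative]
  rcases l with _ | l
  · simp; ring
  · rw [Polynomial.coeff_X_mul, Polynomial.coeff_derivative]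
    push_cast
    ring

lemma TopOp_coeff_zero (M : ℕ) (c : Polynomial ℝ) : (TopOp M c).coeff 0 = 0 := by
  simp [TopOp]

lemma TopOp_natDegree (M : ℕ) (c : Polynomial ℝ) (hc : c.natDegree ≤ M) :
    (TopOp M c).natDegree ≤ M + 1 := by
  rw [Polynomial.natDegree_le_iff_coeff_eq_zero]
  intro N hN
  have h : ∀ i, M < i → c.coeff i = 0 := fun i hi =>
    Polynomial.coeff_eq_zero_of_natDegree_lt (by omega)
  obtain ⟨m, rfl⟩ : ∃ m, N = m + 2 := ⟨N - 2, by omega⟩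
  simp only [TopOp, Polynomial.coeff_sub, Polynomial.coeff_add, Polynomial.coeff_X_mul,
    Polynomial.coeff_derivative, Polynomial.coeff_C_mul]
  rw [h (m + 1 + 1) (by omega), h (m + 1) (by omega)]
  simp

/-! ### The functional argument -/

lemma mem_W_of_mem_U {n M : ℕ} {c : Polynomial ℝ} (h : c ∈ Wn n M (M + 1) n) :
    c ∈ Wn n (M + 1) (M + 2) n := by
  rw [mem_Wn] at h ⊢
  exact ⟨by omega, fun l h1 h2 => h.2 l (by omega) h2⟩

lemma X_mul_mem_W {n M : ℕ} {c : Polynomial ℝ} (h : c ∈ Wn n M (M + 1) n) :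
    Polynomial.X * c ∈ Wn n (M + 1) (M + 2) n := by
  rw [mem_Wn] at h ⊢
  refine ⟨?_, ?_⟩
  · refine (Polynomial.natDegree_mul_le).trans ?_
    rw [Polynomial.natDegree_X]; omega
  · intro l h1 h2
    obtain ⟨m, rfl⟩ : ∃ m, l = m + 1 := ⟨l - 1, by omega⟩
    rw [ec_X_mul]
    exact h.2 m (by omega) (by omega)

lemma TopOp_mem_W {n M : ℕ} {c : Polynomial ℝ} (h : c ∈ Wn n M (M + 1) n) :
    TopOp M c ∈ Wn n (M + 1) (M + 2) n := by
  rw [mem_Wn] at h ⊢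
  refine ⟨TopOp_natDegree M c h.1, ?_⟩
  intro l h1 h2
  obtain ⟨m, rfl⟩ : ∃ m, l = m + 1 := ⟨l - 1, by omega⟩
  rw [ec_TopOp, h.2 m (by omega) (by omega), h.2 (m + 1) (by omega) (by omega)]
  simp

lemma mem_XU {n M : ℕ} {c : Polynomial ℝ} (h : c ∈ Wn n (M + 1) (M + 2) n)
    (h0 : c.coeff 0 = 0) (hq : ec n n c = 0) :
    ∃ d ∈ Wn n M (M + 1) n, c = Polynomial.X * d := by
  obtain ⟨d, rfl⟩ := Polynomial.X_dvd_iff.2 h0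
  refine ⟨d, ?_, rfl⟩
  rw [mem_Wn] at h ⊢
  refine ⟨?_, ?_⟩
  · by_cases hd : d = 0
    · simp [hd]
    · have := h.1
      rw [Polynomial.natDegree_X_mul hd] at this
      omega
  · intro l h1 h2
    rw [← ec_X_mul]
    by_cases hl : l + 1 = n
    · rw [hl]; exact hq
    · exact h.2 _ (by omega) (by omega)

lemma functional_zero (n M J : ℕ) (hn : n = M + J + 2) (hJ : J + 2 ≤ M)
    (r : Wn n (M + 1) (M + 2) n →ₗ[ℝ] ℝ)
    (h1 : ∀ c (hc : c ∈ Wn n M (M + 1) n), r ⟨Polynomial.X * c, X_mul_mem_W hc⟩ = 0)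
    (h2 : ∀ c (hc : c ∈ Wn n M (M + 1) n),
      r ⟨c, mem_W_of_mem_U hc⟩ = r ⟨TopOp M c, TopOp_mem_W hc⟩) : r = 0 := by
  have hker : ∀ c : Wn n (M + 1) (M + 2) n, c.1.coeff 0 = 0 → ec n n c.1 = 0 → r c = 0 := by
    intro c hc0 hcq
    obtain ⟨d, hd, hcd⟩ := mem_XU c.2 hc0 hcq
    have : c = ⟨Polynomial.X * d, X_mul_mem_W hd⟩ := Subtype.ext hcd
    rw [this]; exact h1 d hd
  -- the element u1
  obtain ⟨u1, hu10, hu1d, hu1w⟩ := window_exists n (M + 1) (J + 2) (J + 2) le_rfl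
  have hu1 : u1 ∈ Wn n M (M + 1) n :=
    mem_Wn.2 ⟨by omega, fun l a b => hu1w l a (by omega)⟩
  have hu1q : ec n n u1 = 0 := hu1w n (by omega) (by omega)
  have hu1c : u1.coeff 0 ≠ 0 := by
    intro h
    obtain ⟨d, rfl⟩ := Polynomial.X_dvd_iff.2 h
    have hd : d ≠ 0 := by rintro rfl; simp at hu10
    rw [Polynomial.natDegree_X_mul hd] at hu1d
    have := window_le n M (J + 2) (J + 1) d hd (by omega) (by omega) (by
      intro l a b
      rw [← ec_X_mul]
      exact hu1w _ (by omega) (by omega))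
    omega
  obtain ⟨u2, hu20, hu2d, hu2w⟩ := window_exists n (M + 1) (J + 1) (J + 1) le_rfl
  have hu2 : u2 ∈ Wn n M (M + 1) n :=
    mem_Wn.2 ⟨by omega, fun l a b => hu2w l a (by omega)⟩
  have hu2q : ec n n u2 ≠ 0 := by
    intro h
    have := window_le n (M + 1) (J + 2) (J + 1) u2 hu20 hu2d (by omega) (by
      intro l a b
      by_cases hl : l = n
      · rw [hl]; exact h
      · exact hu2w l a (by omega))
    omega
  have hTq : ∀ c, c ∈ Wn n M (M + 1) n → ec n n (TopOp M c) = n * ec n n c := by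
    intro c hc
    obtain ⟨m, hm⟩ : ∃ m, n = m + 1 := ⟨n - 1, by omega⟩
    have h3 := ec_TopOp n M m c
    rw [(mem_Wn.1 hc).2 m (by omega) (by omega), ← hm] at h3
    rw [h3, hm]; push_cast; ring
  have hr1 : r ⟨u1, mem_W_of_mem_U hu1⟩ = 0 := by
    rw [h2 u1 hu1]
    exact hker _ (TopOp_coeff_zero _ _) (by simp [hTq u1 hu1, hu1q])
  have hr2 : r ⟨u2, mem_W_of_mem_U hu2⟩ = 0 := by
    have h3 := hker (⟨TopOp M u2, TopOp_mem_W hu2⟩ - (n : ℝ) • ⟨u2, mem_W_of_mem_U hu2⟩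
      + ((n : ℝ) * (u2.coeff 0 / u1.coeff 0)) • ⟨u1, mem_W_of_mem_U hu1⟩) (by
        simp only [Submodule.coe_add, Submodule.coe_sub, Submodule.coe_smul, Polynomial.coeff_add,
          Polynomial.coeff_sub, Polynomial.coeff_smul, TopOp_coeff_zero, smul_eq_mul]
        field_simp
        ring) (by
        simp only [Submodule.coe_add, Submodule.coe_sub, Submodule.coe_smul, map_add, map_sub,
          map_smul, hTq u2 hu2, hu1q, smul_eq_mul]
        ring)
    rw [map_add, map_sub, map_smul, map_smul, hr1, ← h2 u2 hu2, smul_eq_mul] at h3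
    have h4 : (1 - (n : ℝ)) * r ⟨u2, mem_W_of_mem_U hu2⟩ = 0 := by
      rw [smul_zero] at h3; linarith
    rcases mul_eq_zero.1 h4 with h5 | h5
    · have : (n : ℝ) = 1 := by linarith
      have : n = 1 := by exact_mod_cast this
      omega
    · exact h5
  ext c
  set β := ec n n c.1 / ec n n u2 with hβ
  set α := (c.1.coeff 0 - β * u2.coeff 0) / u1.coeff 0 with hα
  have h3 := hker (c - β • ⟨u2, mem_W_of_mem_U hu2⟩ - α • ⟨u1, mem_W_of_mem_U hu1⟩) (by
        simp only [Submodule.coe_sub, Submodule.coe_smul,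
          Polynomial.coeff_sub, Polynomial.coeff_smul, smul_eq_mul]
        rw [hα]
        field_simp
        ring) (by
        simp only [Submodule.coe_sub, Submodule.coe_smul, map_sub,
          map_smul, hu1q, smul_eq_mul]
        rw [hβ]
        field_simp
        ring)
  rw [map_sub, map_sub, map_smul, map_smul, hr1, hr2] at h3
  simpa using h3

/-! ### Umbral polynomials -/

/-- homogenised falling factorial -/
def ff (a : S) (i : ℕ) : S := ∏ r ∈ Finset.range i, (a - C (r : ℝ) * X 2)

lemma ff_succ (a : S) (i : ℕ) : ff a (i + 1) = ff a i * (a - C (i : ℝ) * X 2) := by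
  simp [ff, Finset.prod_range_succ]

lemma ff_zero (a : S) : ff a 0 = 1 := by simp [ff]

lemma ff_add (a : S) (i l : ℕ) : ff a (i + l) = ff a i * ff (a - C (i : ℝ) * X 2) l := by
  induction l with
  | zero => simp [ff_zero]
  | succ l ih => rw [← add_assoc, ff_succ, ff_succ, ih]; push_cast; rw [map_add]; ring

def umb (g : ℕ → Polynomial ℝ →ₗ[ℝ] ℝ) (a b : S) (M : ℕ) : Polynomial ℝ →ₗ[ℝ] S :=
  ∑ i ∈ Finset.range (M + 1), (g i).smulRight (ff a i * ff b (M - i))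

lemma umb_apply (g : ℕ → Polynomial ℝ →ₗ[ℝ] ℝ) (a b : S) (M : ℕ) (c : Polynomial ℝ) :
    umb g a b M c = ∑ i ∈ Finset.range (M + 1), C (g i c) * (ff a i * ff b (M - i)) := by
  simp [umb, MvPolynomial.smul_eq_C_mul]

abbrev um (a b : S) (M : ℕ) : Polynomial ℝ →ₗ[ℝ] S := umb (Polynomial.lcoeff ℝ) a b M

lemma um_X_mul (a b : S) (M : ℕ) (c : Polynomial ℝ) :
    um a b (M + 1) (Polynomial.X * c) =
      ∑ i ∈ Finset.range (M + 1), C (c.coeff i) * (ff a (i + 1) * ff b (M - i)) := by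
  rw [umb_apply, Finset.sum_range_succ']
  simp

lemma um_low (a b : S) (M : ℕ) (c : Polynomial ℝ) (hc : c.coeff (M + 1) = 0) :
    um a b (M + 1) c =
      ∑ i ∈ Finset.range (M + 1), C (c.coeff i) * (ff a i * ff b (M - i + 1)) := by
  rw [umb_apply, Finset.sum_range_succ]
  simp only [Polynomial.lcoeff_apply, hc, map_zero, zero_mul, add_zero]
  refine Finset.sum_congr rfl fun i hi => ?_
  rw [Finset.mem_range] at hi
  rw [show M + 1 - i = M - i + 1 by omega]

lemma um_step (a b : S) (M : ℕ) (c : Polynomial ℝ) (hc : c.natDegree ≤ M) :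
    um a b (M + 1) ((1 + Polynomial.X) * c) = (a + b - C (M : ℝ) * X 2) * um a b M c := by
  rw [add_mul, one_mul, map_add, um_X_mul, um_low _ _ _ _
    (Polynomial.coeff_eq_zero_of_natDegree_lt (by omega)), ← Finset.sum_add_distrib, umb_apply,
    Finset.mul_sum]
  refine Finset.sum_congr rfl fun i hi => ?_
  rw [Finset.mem_range] at hi
  rw [ff_succ, ff_succ, Nat.cast_sub (by omega), map_sub]
  simp only [Polynomial.lcoeff_apply]
  ring

lemma um_pow (a b : S) (M n : ℕ) (c : Polynomial ℝ) (hc : c.natDegree ≤ M) :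
    um a b (M + n) ((1 + Polynomial.X) ^ n * c) =
      ff (a + b - C (M : ℝ) * X 2) n * um a b M c := by
  induction n with
  | zero => simp [ff_zero]
  | succ n ih =>
    rw [← add_assoc, pow_succ', mul_assoc, um_step, ih, ff_succ]
    · push_cast; rw [map_add]; ring
    · refine Polynomial.natDegree_mul_le.trans ?_
      have h1 : (1 + Polynomial.X : Polynomial ℝ).natDegree = 1 := by
        rw [add_comm]; exact Polynomial.natDegree_X_add_C (1 : ℝ)
      have := Polynomial.natDegree_pow_le (p := (1 + Polynomial.X : Polynomial ℝ)) (n := n)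
      rw [h1] at this
      omega

lemma um_rel (a b : S) (M : ℕ) (c : Polynomial ℝ) (hc : c.natDegree ≤ M) :
    a * um a b (M + 1) c - b * um a b (M + 1) (Polynomial.X * c)
      = X 2 * um a b (M + 1) (TopOp M c) := by
  have h0 : c.coeff (M + 1) = 0 := Polynomial.coeff_eq_zero_of_natDegree_lt (by omega)
  unfold TopOp
  rw [map_sub, map_add, um_X_mul _ _ _ (Polynomial.C _ * c), um_X_mul _ _ _ (Polynomial.X * _),
    um_X_mul, um_low _ _ _ _ h0, um_low _ _ _ (Polynomial.X * _) (by
      rw [Polynomial.coeff_X_mul, Polynomial.coeff_derivative, h0, zero_mul]),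
    ← Finset.sum_add_distrib, ← Finset.sum_sub_distrib, Finset.mul_sum, Finset.mul_sum,
    Finset.mul_sum, ← Finset.sum_sub_distrib]
  refine Finset.sum_congr rfl fun i hi => ?_
  rw [Finset.mem_range] at hi
  have hx : (Polynomial.X * Polynomial.derivative c).coeff i = i * c.coeff i := by
    rcases i with _ | i
    · simp
    · rw [Polynomial.coeff_X_mul, Polynomial.coeff_derivative]; push_cast; ring
  rw [hx, ff_succ, ff_succ, Nat.cast_sub (by omega), map_sub, Polynomial.coeff_C_mul, map_mul,
    map_mul]
  ring

/-- the triple attached to `c` -/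
def CA (a b : S) (N n : ℕ) : Polynomial ℝ →ₗ[ℝ] S :=
  umb (fun i => ec n (n + i)) (a - C (n : ℝ) * X 2) b N
def CB (a b : S) (N n : ℕ) : Polynomial ℝ →ₗ[ℝ] S :=
  umb (fun i => ec n i) a (b - C (n : ℝ) * X 2) N

lemma triple_syz (a b : S) (N n : ℕ) (hN : N < n) (c : Polynomial ℝ)
    (hc : c ∈ Wn n N (N + 1) n) :
    ff a n * CA a b N n c + ff b n * CB a b N n c =
      ff (a + b - C (N : ℝ) * X 2) n * um a b N c := by
  rw [mem_Wn] at hc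
  rw [← um_pow a b N n c hc.1, umb_apply, CA, CB, umb_apply, umb_apply]
  have h1 : N + n + 1 = (N + 1) + (n - (N + 1)) + (N + 1) := by omega
  rw [h1, Finset.sum_range_add _ (N + 1 + (n - (N + 1))) (N + 1),
    Finset.sum_range_add _ (N + 1) (n - (N + 1))]
  have h2 : ∑ x ∈ Finset.range (n - (N + 1)),
      C ((Polynomial.lcoeff ℝ (N + 1 + x)) ((1 + Polynomial.X) ^ n * c)) *
        (ff a (N + 1 + x) * ff b (N + n - (N + 1 + x))) = 0 := by
    apply Finset.sum_eq_zero
    intro x hx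
    rw [Finset.mem_range] at hx
    have := hc.2 (N + 1 + x) (by omega) (by omega)
    rw [ec_apply] at this
    rw [Polynomial.lcoeff_apply, this]; simp
  rw [h2, add_zero, add_comm, Finset.mul_sum, Finset.mul_sum]
  congr 1
  · refine Finset.sum_congr rfl fun i hi => ?_
    rw [Finset.mem_range] at hi
    rw [show N + n - i = n + (N - i) by omega, ff_add b n, ec_apply]
    simp only [Polynomial.lcoeff_apply]
    ring
  · refine Finset.sum_congr rfl fun i hi => ?_
    rw [Finset.mem_range] at hi
    rw [show N + 1 + (n - (N + 1)) + i = n + i by omega,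
      show N + n - (n + i) = N - i by omega, ff_add a n, ec_apply]
    simp only [Polynomial.lcoeff_apply]
    ring

/-! ### The linear forms and primes -/

lemma dvd_sub_aeval (d : S) (v : Fin 3 → S) (hv : ∀ i, d ∣ X i - v i) (F : S) :
    d ∣ F - aeval v F := by
  induction F using MvPolynomial.induction_on with
  | C r => simp [MvPolynomial.algebraMap_eq]
  | add p q hp hq =>
    rw [map_add, show p + q - (aeval v p + aeval v q) = (p - aeval v p) + (q - aeval v q) by ring]
    exact dvd_add hp hq
  | mul_X p i hp =>
    rw [map_mul, aeval_X, show p * X i - aeval v p * v i =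
      (p - aeval v p) * X i + aeval v p * (X i - v i) by ring]
    exact dvd_add (Dvd.dvd.mul_right hp _) (Dvd.dvd.mul_left (hv i) _)

lemma prime_of_sub (d : S) (v : Fin 3 → S) (hd : d ≠ 0) (hv : ∀ i, d ∣ X i - v i)
    (h0 : aeval v d = 0) : Prime d := by
  have key : ∀ F : S, aeval v F = 0 → d ∣ F := by
    intro F hF
    have := dvd_sub_aeval d v hv F
    rwa [hF, sub_zero] at this
  have key2 : ∀ F : S, d ∣ F → aeval v F = 0 := by
    rintro F ⟨G, rfl⟩
    rw [map_mul, h0, zero_mul]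
  refine ⟨hd, ?_, ?_⟩
  · intro hu
    have := hu.map (aeval v : S →ₐ[ℝ] S)
    rw [h0] at this
    exact not_isUnit_zero this
  · intro a b hab
    have := key2 _ hab
    rw [map_mul] at this
    rcases mul_eq_zero.1 this with h | h
    · exact Or.inl (key _ h)
    · exact Or.inr (key _ h)

def LL : Fin 3 → S := ![X 0, X 1, X 0 + X 1]

def al (i : Fin 3) (s : ℤ) : S := LL i - C (s : ℝ) * X 2

lemma LL_hom (i : Fin 3) : (LL i).IsHomogeneous 1 := by
  fin_cases i
  · exact isHomogeneous_X _ _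
  · exact isHomogeneous_X _ _
  · exact (isHomogeneous_X _ _).add (isHomogeneous_X _ _)

lemma al_hom (i : Fin 3) (s : ℤ) : (al i s).IsHomogeneous 1 :=
  (LL_hom i).sub (isHomogeneous_C_mul_X _ _)

lemma not_dvd_of_point (p : Fin 3 → ℝ) (F G : S) (hF : eval p F = 0) (hG : eval p G ≠ 0) :
    ¬ F ∣ G := by
  rintro ⟨H, rfl⟩
  rw [map_mul, hF, zero_mul] at hG
  exact hG rfl

lemma al_ne_zero (i : Fin 3) (s : ℤ) : al i s ≠ 0 := by
  intro h
  have : eval ![1, 1, 0] (al i s) = 0 := by rw [h, map_zero]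
  fin_cases i <;> simp [al, LL] at this

lemma al_prime (i : Fin 3) (s : ℤ) : Prime (al i s) := by
  fin_cases i
  · apply prime_of_sub _ ![C (s : ℝ) * X 2, X 1, X 2] (al_ne_zero _ _)
    · intro i; fin_cases i <;> simp [al, LL]
    · simp [al, LL, MvPolynomial.algebraMap_eq]
  · apply prime_of_sub _ ![X 0, C (s : ℝ) * X 2, X 2] (al_ne_zero _ _)
    · intro i; fin_cases i <;> simp [al, LL]
    · simp [al, LL, MvPolynomial.algebraMap_eq]
  · apply prime_of_sub _ ![C (s : ℝ) * X 2 - X 1, X 1, X 2] (al_ne_zero _ _)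
    · intro i; fin_cases i <;> simp [al, LL]
      exact dvd_of_eq (by ring)
    · simp [al, LL, MvPolynomial.algebraMap_eq]

lemma al_not_dvd_z (i : Fin 3) (s : ℤ) : ¬ al i s ∣ X 2 := by
  fin_cases i
  · exact not_dvd_of_point ![s, 0, 1] _ _ (by simp [al, LL]) (by simp)
  · exact not_dvd_of_point ![0, s, 1] _ _ (by simp [al, LL]) (by simp)
  · exact not_dvd_of_point ![s, 0, 1] _ _ (by simp [al, LL]) (by simp)

lemma z_not_dvd_al (i : Fin 3) (s : ℤ) : ¬ (X 2 : S) ∣ al i s := by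
  apply not_dvd_of_point ![1, 1, 0] _ _ (by simp)
  fin_cases i <;> simp [al, LL]

lemma al_not_dvd_al (i i' : Fin 3) (s s' : ℤ) (h : (i, s) ≠ (i', s')) :
    ¬ al i s ∣ al i' s' := by
  by_cases hi : i = i'
  · subst hi
    have hs : (s : ℝ) ≠ s' := by
      intro h'
      apply h
      have : s = s' := by exact_mod_cast h'
      rw [this]
    fin_cases i
    · exact not_dvd_of_point ![s, 0, 1] _ _ (by simp [al, LL]) (by simp [al, LL, sub_eq_zero, hs])
    · exact not_dvd_of_point ![0, s, 1] _ _ (by simp [al, LL]) (by simp [al, LL, sub_eq_zero, hs])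
    · exact not_dvd_of_point ![s, 0, 1] _ _ (by simp [al, LL]) (by simp [al, LL, sub_eq_zero, hs])
  · fin_cases i <;> fin_cases i' <;> first | exact absurd rfl hi | skip
    · exact not_dvd_of_point ![s, s' + 1, 1] _ _ (by simp [al, LL]) (by simp [al, LL])
    · exact not_dvd_of_point ![s, s' + 1 - s, 1] _ _ (by simp [al, LL]) (by simp [al, LL])
    · exact not_dvd_of_point ![s' + 1, s, 1] _ _ (by simp [al, LL]) (by simp [al, LL])
    · exact not_dvd_of_point ![s' + 1 - s, s, 1] _ _ (by simp [al, LL]) (by simp [al, LL])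
    · exact not_dvd_of_point ![s' + 1, s - (s' + 1), 1] _ _ (by simp [al, LL]) (by simp [al, LL])
    · exact not_dvd_of_point ![s - (s' + 1), s' + 1, 1] _ _ (by simp [al, LL]) (by simp [al, LL])

/-- index interval -/
def II (j k : ℕ) : Finset ℤ := Finset.Icc (-(j : ℤ)) ((k : ℤ) + j)

lemma card_II (j k : ℕ) : (II j k).card = k + 2 * j + 1 := by
  simp [II]; omega

def pr (j k : ℕ) (i : Fin 3) : S := ∏ s ∈ II j k, al i s

lemma fjk_eq (j k : ℕ) : fjk j k = X 2 * (pr j k 0 * pr j k 1 * pr j k 2) := by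
  unfold fjk pr
  rw [← Finset.prod_mul_distrib, ← Finset.prod_mul_distrib]
  rfl

lemma fjk_eq' (j k : ℕ) :
    fjk j k = X 2 * ∏ p ∈ (Finset.univ : Finset (Fin 3)) ×ˢ II j k, al p.1 p.2 := by
  rw [fjk_eq, Finset.prod_product, Fin.prod_univ_three]; rfl

lemma pr_hom (j k : ℕ) (i : Fin 3) : (pr j k i).IsHomogeneous (k + 2 * j + 1) := by
  have := IsHomogeneous.prod (II j k) (fun s => al i s) (fun _ => 1) (fun s _ => al_hom i s)
  simpa [card_II, pr] using this

lemma pr_ne_zero (j k : ℕ) (i : Fin 3) : pr j k i ≠ 0 :=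
  Finset.prod_ne_zero_iff.2 fun s _ => al_ne_zero i s

lemma fjk_ne_zero (j k : ℕ) : fjk j k ≠ 0 := by
  rw [fjk_eq]
  exact mul_ne_zero (X_ne_zero _) (mul_ne_zero (mul_ne_zero (pr_ne_zero _ _ _) (pr_ne_zero _ _ _))
    (pr_ne_zero _ _ _))

lemma fjk_hom (j k : ℕ) : (fjk j k).IsHomogeneous (3 * (k + 2 * j + 1) + 1) := by
  rw [fjk_eq]
  have := (isHomogeneous_X ℝ (2 : Fin 3)).mul
    (((pr_hom j k 0).mul (pr_hom j k 1)).mul (pr_hom j k 2))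
  convert this using 1
  ring

lemma pr_dvd (j k : ℕ) (i : Fin 3) (F : S) (h : ∀ s ∈ II j k, al i s ∣ F) : pr j k i ∣ F := by
  apply Finset.prod_dvd_of_isRelPrime
  · intro s _ t _ hst
    exact (al_prime i s).irreducible.isRelPrime_iff_not_dvd.2
      (al_not_dvd_al i i s t (by simpa using hst))
  · exact h

lemma zpr_dvd (j k : ℕ) (i : Fin 3) (F : S) (h : ∀ s ∈ II j k, al i s ∣ F) (hz : X 2 ∣ F) :
    X 2 * pr j k i ∣ F := by
  obtain ⟨G, rfl⟩ := hz
  apply mul_dvd_mul_left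
  apply pr_dvd
  intro s hs
  exact ((al_prime i s).dvd_or_dvd (h s hs)).resolve_left (al_not_dvd_z i s)

lemma log_dvd (f α g : S) (hα : Prime α) (hf : f = α * g) (hg : ¬ α ∣ g)
    (θ : Derivation ℝ S S) (hθ : θ f = 0) : α ∣ θ α := by
  rw [hf, Derivation.leibniz, smul_eq_mul, smul_eq_mul] at hθ
  have : α ∣ g * θ α := ⟨- θ g, by linear_combination hθ⟩
  exact (hα.dvd_or_dvd this).resolve_left hg

lemma z_dvd (j k : ℕ) (θ : Derivation ℝ S S) (hθ : θ (fjk j k) = 0) : X 2 ∣ θ (X 2) := by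
  apply log_dvd _ _ _ (X_prime) (fjk_eq' j k) _ θ hθ
  rw [(X_prime).dvd_finsetProd_iff]
  rintro ⟨p, _, hp⟩
  exact z_not_dvd_al _ _ hp

lemma al_dvd (j k : ℕ) (θ : Derivation ℝ S S) (hθ : θ (fjk j k) = 0) (i : Fin 3) (s : ℤ)
    (hs : s ∈ II j k) : al i s ∣ θ (al i s) := by
  apply log_dvd (fjk j k) _
    (X 2 * ∏ p ∈ ((Finset.univ : Finset (Fin 3)) ×ˢ II j k).erase (i, s), al p.1 p.2)
    (al_prime i s) _ _ θ hθ
  · rw [fjk_eq', ← Finset.mul_prod_erase _ _ (show (i, s) ∈ (Finset.univ : Finset (Fin 3)) ×ˢ II j k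
      by simpa using hs)]
    ring
  · intro h
    rcases (al_prime i s).dvd_or_dvd h with h | h
    · exact al_not_dvd_z _ _ h
    · rw [(al_prime i s).dvd_finsetProd_iff] at h
      obtain ⟨p, hp, h⟩ := h
      rw [Finset.mem_erase] at hp
      exact al_not_dvd_al _ _ _ _ hp.1.symm h

/-- `z θ(L) - L θ(z)` -/
def Del (i : Fin 3) (θ : Derivation ℝ S S) : S := X 2 * θ (LL i) - LL i * θ (X 2)

lemma Del_dvd (j k : ℕ) (θ : Derivation ℝ S S) (hθ : θ (fjk j k) = 0) (i : Fin 3) :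
    X 2 * pr j k i ∣ Del i θ := by
  apply zpr_dvd
  · intro s hs
    have h := al_dvd j k θ hθ i s hs
    have h2 : Del i θ = X 2 * θ (al i s) - al i s * θ (X 2) := by
      unfold Del al
      rw [map_sub, Derivation.leibniz, ← MvPolynomial.algebraMap_eq, Derivation.map_algebraMap]
      simp only [smul_eq_mul]
      ring
    rw [h2]
    exact dvd_sub (Dvd.dvd.mul_left h _) (Dvd.intro _ rfl)
  · exact dvd_sub (Dvd.intro _ rfl) (Dvd.dvd.mul_left (z_dvd j k θ hθ) _)

/-- the quotient `Del i θ / (z π_i)` -/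
def Lam (j k : ℕ) (i : Fin 3) (θ : D0 (fjk j k)) : S := (Del_dvd j k θ.1 θ.2 i).choose

lemma Lam_spec (j k : ℕ) (i : Fin 3) (θ : D0 (fjk j k)) :
    Del i θ.1 = X 2 * pr j k i * Lam j k i θ := (Del_dvd j k θ.1 θ.2 i).choose_spec

lemma zpr_ne_zero (j k : ℕ) (i : Fin 3) : X 2 * pr j k i ≠ 0 :=
  mul_ne_zero (X_ne_zero _) (pr_ne_zero _ _ _)

lemma Lam_add (j k : ℕ) (i : Fin 3) (θ η : D0 (fjk j k)) :
    Lam j k i (θ + η) = Lam j k i θ + Lam j k i η := by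
  apply mul_left_cancel₀ (zpr_ne_zero j k i)
  rw [mul_add, ← Lam_spec, ← Lam_spec, ← Lam_spec]
  simp only [Del, Submodule.coe_add, Derivation.add_apply]
  ring

lemma Lam_smul (j k : ℕ) (i : Fin 3) (c : S) (θ : D0 (fjk j k)) :
    Lam j k i (c • θ) = c * Lam j k i θ := by
  apply mul_left_cancel₀ (zpr_ne_zero j k i)
  rw [mul_left_comm, ← Lam_spec, ← Lam_spec]
  simp only [Del, Submodule.coe_smul, Derivation.smul_apply, smul_eq_mul]
  ring

def LamL (j k : ℕ) (i : Fin 3) : D0 (fjk j k) →ₗ[S] S where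
  toFun := Lam j k i
  map_add' := Lam_add j k i
  map_smul' := Lam_smul j k i

lemma Lam_syz (j k : ℕ) (θ : D0 (fjk j k)) :
    pr j k 0 * Lam j k 0 θ + pr j k 1 * Lam j k 1 θ = pr j k 2 * Lam j k 2 θ := by
  apply mul_left_cancel₀ (X_ne_zero (R := ℝ) (2 : Fin 3))
  have h0 := Lam_spec j k 0 θ
  have h1 := Lam_spec j k 1 θ
  have h2 := Lam_spec j k 2 θ
  have h3 : Del 2 θ.1 = Del 0 θ.1 + Del 1 θ.1 := by
    simp only [Del, LL, Matrix.cons_val_zero, Matrix.cons_val_one, Matrix.cons_val, map_add]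
    ring
  linear_combination h2 - h0 - h1 - h3

lemma hom_quot (P Q : S) (m e : ℕ) (hP : P.IsHomogeneous m) (hP0 : P ≠ 0)
    (h : (P * Q).IsHomogeneous (m + e)) : Q.IsHomogeneous e := by
  have h1 : homogeneousComponent (m + e) (P * Q) = P * homogeneousComponent e Q := by
    letI := MvPolynomial.gradedAlgebra (σ := Fin 3) (R := ℝ)
    have := DirectSum.coe_decompose_mul_add_of_left_mem (homogeneousSubmodule (Fin 3) ℝ)
      (a := P) (b := Q) (i := m) (j := e) hP
    rw [← decomposition.decompose'_apply, ← decomposition.decompose'_apply]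
    exact this
  rw [homogeneousComponent_eq_self h] at h1
  rw [mul_left_cancel₀ hP0 h1]
  exact homogeneousComponent_isHomogeneous _ _

lemma Lam_hom (j k : ℕ) (i : Fin 3) (θ : D0 (fjk j k)) (N : ℕ)
    (h : IsHomogDer θ.1 (k + 2 * j + 1 + N)) : (Lam j k i θ).IsHomogeneous N := by
  apply hom_quot (X 2 * pr j k i) _ (1 + (k + 2 * j + 1)) N
    ((isHomogeneous_X _ _).mul (pr_hom _ _ _)) (zpr_ne_zero _ _ _)
  rw [← Lam_spec]
  have hL : (θ.1 (LL i)).IsHomogeneous (k + 2 * j + 1 + N) := by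
    fin_cases i
    · exact h 0
    · exact h 1
    · simp only [LL, Fin.reduceFinMk, Matrix.cons_val, map_add]
      exact (h 0).add (h 1)
  rw [add_assoc]
  exact ((isHomogeneous_X _ _).mul hL).sub ((LL_hom i).mul (h 2))

/-- Euler derivation -/
def EE : Derivation ℝ S S := ∑ i : Fin 3, (X i : S) • pderiv i

lemma EE_hom (f : S) (n : ℕ) (h : f.IsHomogeneous n) : EE f = C (n : ℝ) * f := by
  have := h.sum_X_mul_pderiv
  simp only [EE, Fin.sum_univ_three, Derivation.add_apply, Derivation.smul_apply, smul_eq_mul] at this ⊢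
  rw [this, nsmul_eq_mul]
  simp

lemma EE_X (i : Fin 3) : EE (X i) = X i := by
  rw [EE_hom _ 1 (isHomogeneous_X _ _)]; simp

lemma eq_zero_of_Del (j k : ℕ) (θ : D0 (fjk j k)) (h0 : Del 0 θ.1 = 0) (h1 : Del 1 θ.1 = 0) :
    θ = 0 := by
  obtain ⟨g, hg⟩ := z_dvd j k θ.1 θ.2
  have e0 : θ.1 (X 0) = g * X 0 := by
    apply mul_left_cancel₀ (X_ne_zero (R := ℝ) (2 : Fin 3))
    simp only [Del, LL, Matrix.cons_val_zero, hg] at h0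
    linear_combination h0
  have e1 : θ.1 (X 1) = g * X 1 := by
    apply mul_left_cancel₀ (X_ne_zero (R := ℝ) (2 : Fin 3))
    simp only [Del, show LL 1 = X 1 from rfl, hg] at h1
    linear_combination h1
  have hθ : θ.1 = g • EE := by
    apply MvPolynomial.derivation_ext
    intro i
    rw [Derivation.smul_apply, EE_X, smul_eq_mul]
    fin_cases i
    · exact e0
    · exact e1
    · simpa [mul_comm] using hg
  have h2 : θ.1 (fjk j k) = 0 := θ.2
  rw [hθ, Derivation.smul_apply, EE_hom _ _ (fjk_hom j k), smul_eq_mul] at h2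
  have hc : (C ((3 * (k + 2 * j + 1) + 1 : ℕ) : ℝ) : S) ≠ 0 := by
    rw [Ne, C_eq_zero]
    positivity
  rcases mul_eq_zero.1 h2 with h3 | h3
  · apply Subtype.ext
    rw [hθ, h3, zero_smul]; rfl
  · exact absurd h3 (mul_ne_zero hc (fjk_ne_zero j k))

lemma low_syz (j k : ℕ) (A B : S) (e : ℕ) (he : e < k + 2 * j + 1) (hA : A.IsHomogeneous e)
    (h : pr j k 0 * A + pr j k 1 * B = 0) : A = 0 ∧ B = 0 := by
  have hA0 : A = 0 := by
    by_contra hne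
    have hd : pr j k 1 ∣ A := by
      apply pr_dvd
      intro s hs
      have h1 : al 1 s ∣ pr j k 0 * A := by
        have : al 1 s ∣ pr j k 1 := Finset.dvd_prod_of_mem _ hs
        rw [eq_neg_of_add_eq_zero_left h]
        exact (Dvd.dvd.mul_right this _).neg_right
      refine ((al_prime 1 s).dvd_or_dvd h1).resolve_left ?_
      rw [pr, (al_prime 1 s).dvd_finsetProd_iff]
      rintro ⟨t, _, ht⟩
      exact al_not_dvd_al 1 0 s t (by simp) ht
    obtain ⟨Q, rfl⟩ := hd
    have hQ : Q ≠ 0 := right_ne_zero_of_mul hne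
    have h2 := hA.totalDegree hne
    rw [totalDegree_mul_of_isDomain (pr_ne_zero _ _ _) hQ,
      (pr_hom j k 1).totalDegree (pr_ne_zero _ _ _)] at h2
    omega
  refine ⟨hA0, ?_⟩
  rw [hA0, mul_zero, zero_add] at h
  exact (mul_eq_zero.1 h).resolve_left (pr_ne_zero _ _ _)

lemma eq_zero_of_Lam2 (j k : ℕ) (θ : D0 (fjk j k)) (N : ℕ) (hN : N < k + 2 * j + 1)
    (h : IsHomogDer θ.1 (k + 2 * j + 1 + N)) (h2 : Lam j k 2 θ = 0) : θ = 0 := by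
  have hs := Lam_syz j k θ
  rw [h2, mul_zero] at hs
  obtain ⟨h0, h1⟩ := low_syz j k _ _ N hN (Lam_hom j k 0 θ N h) hs
  apply eq_zero_of_Del
  · rw [Lam_spec, h0, mul_zero]
  · rw [Lam_spec, h1, mul_zero]

/-! ### Constructing derivations from syzygies -/

lemma deriv_prod (D : Derivation ℝ S S) (T : Finset ℤ) (g : ℤ → S) :
    D (∏ s ∈ T, g s) = ∑ s ∈ T, (∏ t ∈ T.erase s, g t) * D (g s) := by
  induction T using Finset.induction_on with
  | empty => simp
  | insert a T ha ih =>
    rw [Finset.prod_insert ha, Derivation.leibniz, ih, Finset.sum_insert ha,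
      Finset.erase_insert ha, smul_eq_mul, smul_eq_mul, Finset.mul_sum, add_comm]
    congr 1
    refine Finset.sum_congr rfl fun s hs => ?_
    have hne : a ≠ s := fun h => ha (h ▸ hs)
    rw [Finset.erase_insert_of_ne hne, Finset.prod_insert (fun h => ha (Finset.mem_of_mem_erase h))]
    ring

def dq (j k : ℕ) (i : Fin 3) : S := ∑ s ∈ II j k, ∏ t ∈ (II j k).erase s, al i t

lemma dq_hom (j k : ℕ) (i : Fin 3) : (dq j k i).IsHomogeneous (k + 2 * j) := by
  apply IsHomogeneous.sum
  intro s hs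
  have := IsHomogeneous.prod ((II j k).erase s) (fun s => al i s) (fun _ => 1)
    (fun s _ => al_hom i s)
  simpa [card_II, Finset.card_erase_of_mem hs] using this

lemma deriv_pr (j k : ℕ) (i : Fin 3) (D : Derivation ℝ S S) (hD : D (X 2) = 0) :
    D (pr j k i) = D (LL i) * dq j k i := by
  unfold pr dq
  rw [deriv_prod, Finset.mul_sum]
  refine Finset.sum_congr rfl fun s _ => ?_
  have : D (al i s) = D (LL i) := by
    unfold al
    rw [map_sub, Derivation.leibniz, ← MvPolynomial.algebraMap_eq, Derivation.map_algebraMap, hD]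
    simp
  rw [this, mul_comm]

lemma Del_EE (i : Fin 3) : Del i EE = 0 := by
  unfold Del
  rw [EE_hom _ 1 (LL_hom i), EE_X]
  simp [mul_comm]

lemma exists_der (j k : ℕ) (A B Q : S) (hs : pr j k 0 * A + pr j k 1 * B = pr j k 2 * Q) :
    ∃ θ : D0 (fjk j k), Lam j k 0 θ = A ∧ Lam j k 1 θ = B ∧ Lam j k 2 θ = Q ∧
      ∀ e, A.IsHomogeneous e → B.IsHomogeneous e → Q.IsHomogeneous e →
        IsHomogDer θ.1 (k + 2 * j + 1 + e) := by
  set D : Derivation ℝ S S := mkDerivation ℝ ![pr j k 0 * A, pr j k 1 * B, 0] with hDdef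
  have d0 : D (X 0) = pr j k 0 * A := by rw [hDdef, mkDerivation_X]; rfl
  have d1 : D (X 1) = pr j k 1 * B := by rw [hDdef, mkDerivation_X]; rfl
  have d2 : D (X 2) = 0 := by rw [hDdef, mkDerivation_X]; rfl
  have l0 : D (LL 0) = pr j k 0 * A := d0
  have l1 : D (LL 1) = pr j k 1 * B := d1
  have l2 : D (LL 2) = pr j k 2 * Q := by
    rw [show LL 2 = X 0 + X 1 from rfl, map_add, d0, d1, hs]
  set h : S := A * dq j k 0 + B * dq j k 1 + Q * dq j k 2 with hh
  have hDf : D (fjk j k) = h * fjk j k := by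
    rw [fjk_eq]
    simp only [Derivation.leibniz, smul_eq_mul, d2, deriv_pr j k _ D d2, l0, l1, l2]
    rw [hh]; ring
  set m : ℝ := ((3 * (k + 2 * j + 1) + 1 : ℕ) : ℝ) with hm
  have hm0 : m ≠ 0 := by rw [hm]; positivity
  set g : S := C m⁻¹ * h with hg
  set E : Derivation ℝ S S := D - g • EE with hE
  have hEf : E (fjk j k) = 0 := by
    rw [hE, Derivation.sub_apply, Derivation.smul_apply, EE_hom _ _ (fjk_hom j k), hDf, ← hm, hg,
      smul_eq_mul]
    have : (C m⁻¹ * C m : S) = 1 := by rw [← map_mul, inv_mul_cancel₀ hm0, map_one]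
    linear_combination (- h * fjk j k) * this
  have hDel : ∀ i, Del i E = X 2 * D (LL i) := by
    intro i
    have h1 := Del_EE i
    unfold Del at h1 ⊢
    rw [hE]
    simp only [Derivation.sub_apply, Derivation.smul_apply, smul_eq_mul, d2]
    linear_combination (-g) * h1
  refine ⟨⟨E, hEf⟩, ?_, ?_, ?_, ?_⟩
  · apply mul_left_cancel₀ (zpr_ne_zero j k 0)
    rw [← Lam_spec, hDel, l0]; ring
  · apply mul_left_cancel₀ (zpr_ne_zero j k 1)
    rw [← Lam_spec, hDel, l1]; ring
  · apply mul_left_cancel₀ (zpr_ne_zero j k 2)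
    rw [← Lam_spec, hDel, l2]; ring
  · intro e hA hB hQ i
    have hh1 : h.IsHomogeneous (e + (k + 2 * j)) :=
      ((hA.mul (dq_hom _ _ _)).add (hB.mul (dq_hom _ _ _))).add (hQ.mul (dq_hom _ _ _))
    have hg1 : (g * X i).IsHomogeneous (k + 2 * j + 1 + e) := by
      have := ((isHomogeneous_C (Fin 3) m⁻¹).mul hh1).mul (isHomogeneous_X ℝ i)
      convert this using 1
      omega
    have hD1 : (D (X i)).IsHomogeneous (k + 2 * j + 1 + e) := by
      fin_cases i
      · exact d0 ▸ (pr_hom j k 0).mul hA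
      · exact d1 ▸ (pr_hom j k 1).mul hB
      · exact d2 ▸ isHomogeneous_zero _ _ _
    change (E (X i)).IsHomogeneous _
    rw [hE, Derivation.sub_apply, Derivation.smul_apply, EE_X, smul_eq_mul]
    exact hD1.sub hg1

lemma eq_of_Lam (j k : ℕ) (θ η : D0 (fjk j k)) (h0 : Lam j k 0 θ = Lam j k 0 η)
    (h1 : Lam j k 1 θ = Lam j k 1 η) : θ = η := by
  have : ∀ i, Lam j k i (θ - η) = Lam j k i θ - Lam j k i η := fun i => map_sub (LamL j k i) θ η
  rw [← sub_eq_zero]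
  apply eq_zero_of_Del
  · rw [Lam_spec, this, h0, sub_self, mul_zero]
  · rw [Lam_spec, this, h1, sub_self, mul_zero]

lemma ff_hom (a : S) (ha : a.IsHomogeneous 1) (i : ℕ) : (ff a i).IsHomogeneous i := by
  have := IsHomogeneous.prod (Finset.range i) (fun r => a - C (r : ℝ) * X 2) (fun _ => 1)
    (fun s _ => ha.sub (isHomogeneous_C_mul_X _ _))
  simpa [ff] using this

lemma umb_hom (g : ℕ → Polynomial ℝ →ₗ[ℝ] ℝ) (a b : S) (ha : a.IsHomogeneous 1)
    (hb : b.IsHomogeneous 1) (M : ℕ) (c : Polynomial ℝ) : (umb g a b M c).IsHomogeneous M := by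
  rw [umb_apply]
  apply IsHomogeneous.sum
  intro i hi
  rw [Finset.mem_range] at hi
  have := (isHomogeneous_C (Fin 3) (g i c)).mul ((ff_hom a ha i).mul (ff_hom b hb (M - i)))
  convert this using 1
  omega

lemma pr_eq_ff (j k : ℕ) (i : Fin 3) : pr j k i = (-1) ^ (k + 2 * j + 1) *
    ff (C ((k + j : ℕ) : ℝ) * X 2 - LL i) (k + 2 * j + 1) := by
  have h : pr j k i = ∏ r ∈ Finset.range (k + 2 * j + 1),
      ((-1) * (C ((k + j : ℕ) : ℝ) * X 2 - LL i - C (r : ℝ) * X 2)) := by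
    unfold pr
    refine Finset.prod_nbij' (fun s => ((k : ℤ) + j - s).toNat) (fun r => (k : ℤ) + j - r)
      ?_ ?_ ?_ ?_ ?_
    · intro s hs; simp only [II, Finset.mem_Icc, Finset.mem_range] at hs ⊢; omega
    · intro s hs; simp only [II, Finset.mem_Icc, Finset.mem_range] at hs ⊢; omega
    · intro s hs; simp only [II, Finset.mem_Icc] at hs ⊢; omega
    · intro s hs; simp only [Finset.mem_range] at hs ⊢; omega
    · intro s hs
      simp only [II, Finset.mem_Icc] at hs
      have : ((((k : ℤ) + j - s).toNat : ℕ) : ℝ) = (k : ℝ) + j - s := by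
        have : ((((k : ℤ) + j - s).toNat : ℕ) : ℤ) = (k : ℤ) + j - s := by omega
        exact_mod_cast this
      rw [this, al]
      push_cast
      simp only [map_sub, map_add]
      ring
  rw [h, Finset.prod_mul_distrib, Finset.prod_const, Finset.card_range, ff]

def fa (N : ℕ) : S := C (N : ℝ) * X 2 - X 0
def fb (N : ℕ) : S := C (N : ℝ) * X 2 - X 1

lemma fa_hom (N : ℕ) : (fa N).IsHomogeneous 1 :=
  (isHomogeneous_C_mul_X _ _).sub (isHomogeneous_X _ _)
lemma fb_hom (N : ℕ) : (fb N).IsHomogeneous 1 :=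
  (isHomogeneous_C_mul_X _ _).sub (isHomogeneous_X _ _)

lemma th_syz (j k N n : ℕ) (hN : N = k + j) (hn : n = k + 2 * j + 1) (c : Polynomial ℝ)
    (hc : c ∈ Wn n N (N + 1) n) :
    pr j k 0 * CA (fa N) (fb N) N n c + pr j k 1 * CB (fa N) (fb N) N n c =
      pr j k 2 * um (fa N) (fb N) N c := by
  have h := triple_syz (fa N) (fb N) N n (by omega) c hc
  rw [pr_eq_ff, pr_eq_ff, pr_eq_ff, ← hN, ← hn]
  rw [show fa N + fb N - C (N : ℝ) * X 2 = C (N : ℝ) * X 2 - LL 2 by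
    simp only [fa, fb, show LL 2 = X 0 + X 1 from rfl]; ring] at h
  rw [show C (N : ℝ) * X 2 - LL 0 = fa N from rfl, show C (N : ℝ) * X 2 - LL 1 = fb N from rfl]
  linear_combination (-1) ^ n * h

/-- the derivation attached to a polynomial `c` -/
lemma exists_th (j k N n : ℕ) (hN : N = k + j) (hn : n = k + 2 * j + 1) :
    ∃ th : Wn n N (N + 1) n → D0 (fjk j k), ∀ c,
      Lam j k 0 (th c) = CA (fa N) (fb N) N n c.1 ∧
      Lam j k 1 (th c) = CB (fa N) (fb N) N n c.1 ∧
      Lam j k 2 (th c) = um (fa N) (fb N) N c.1 ∧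
      IsHomogDer (th c).1 (n + N) := by
  have : ∀ c : Wn n N (N + 1) n, ∃ θ : D0 (fjk j k),
      Lam j k 0 θ = CA (fa N) (fb N) N n c.1 ∧
      Lam j k 1 θ = CB (fa N) (fb N) N n c.1 ∧
      Lam j k 2 θ = um (fa N) (fb N) N c.1 ∧
      IsHomogDer θ.1 (n + N) := by
    intro c
    obtain ⟨θ, h0, h1, h2, h3⟩ := exists_der j k _ _ _ (th_syz j k N n hN hn c.1 c.2)
    refine ⟨θ, h0, h1, h2, ?_⟩
    rw [hn]
    apply h3
    · exact umb_hom _ _ _ ((fa_hom N).sub (isHomogeneous_C_mul_X _ _)) (fb_hom N) _ _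
    · exact umb_hom _ _ _ (fa_hom N) ((fb_hom N).sub (isHomogeneous_C_mul_X _ _)) _ _
    · exact umb_hom _ _ _ (fa_hom N) (fb_hom N) _ _
  choose th hth using this
  exact ⟨th, hth⟩

lemma eval_ff (p : Fin 3 → ℝ) (hp : p 2 = 0) (a : S) (i : ℕ) : eval p (ff a i) = eval p a ^ i := by
  simp [ff, map_prod, hp]

lemma um_inj (N : ℕ) (c : Polynomial ℝ) (hc : c.natDegree ≤ N) (h : um (fa N) (fb N) N c = 0) :
    c = 0 := by
  apply Polynomial.funext
  intro t
  have h1 : eval ![t, 1, 0] (um (fa N) (fb N) N c) = (-1) ^ N * c.eval t := by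
    rw [umb_apply, map_sum, Polynomial.eval_eq_sum_range' (Nat.lt_succ_of_le hc), Finset.mul_sum]
    refine Finset.sum_congr rfl fun i hi => ?_
    rw [map_mul, map_mul, eval_ff _ (by simp), eval_ff _ (by simp)]
    have hi' : i ≤ N := by rw [Finset.mem_range] at hi; omega
    have hpow : ((-1 : ℝ)) ^ N = (-1) ^ i * (-1) ^ (N - i) := by rw [← pow_add]; congr 1; omega
    rw [hpow]
    simp only [fa, fb, Polynomial.lcoeff_apply, eval_C, map_sub, map_mul, eval_X,
      Matrix.cons_val, mul_zero, zero_sub, Matrix.cons_val_zero, Matrix.cons_val_one]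
    rw [neg_pow t]
    ring
  rw [h, map_zero] at h1
  have : ((-1 : ℝ)) ^ N ≠ 0 := pow_ne_zero _ (by norm_num)
  rw [Polynomial.eval_zero]
  exact (mul_eq_zero.1 h1.symm).resolve_left this

/-- all needed facts on the source side -/
lemma source (j k N n : ℕ) (hN : N = k + j) (hn : n = k + 2 * j + 1)
    (th : Wn n N (N + 1) n → D0 (fjk j k))
    (h : ∀ c, Lam j k 0 (th c) = CA (fa N) (fb N) N n c.1 ∧
      Lam j k 1 (th c) = CB (fa N) (fb N) N n c.1 ∧
      Lam j k 2 (th c) = um (fa N) (fb N) N c.1 ∧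
      IsHomogDer (th c).1 (n + N)) :
    (∀ c d, th (c + d) = th c + th d) ∧ (∀ (r : ℝ) c, th (r • c) = (C r : S) • th c) ∧
    (∀ c, th c = 0 → c = 0) := by
  refine ⟨?_, ?_, ?_⟩
  · intro c d
    apply eq_of_Lam
    · rw [Lam_add, (h _).1, (h _).1, (h _).1, Submodule.coe_add, map_add]
    · rw [Lam_add, (h _).2.1, (h _).2.1, (h _).2.1, Submodule.coe_add, map_add]
  · intro r c
    apply eq_of_Lam
    · rw [Lam_smul, (h _).1, (h _).1, Submodule.coe_smul, map_smul, MvPolynomial.smul_eq_C_mul]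
    · rw [Lam_smul, (h _).2.1, (h _).2.1, Submodule.coe_smul, map_smul,
        MvPolynomial.smul_eq_C_mul]
  · intro c hc
    have h2 := (h c).2.2.1
    rw [hc] at h2
    apply Subtype.ext
    exact um_inj N c.1 (mem_Wn.1 c.2).1 (h2.symm.trans (map_zero (LamL j k 2)))

lemma source_rel (j k M n : ℕ) (hN : M + 1 = k + j) (hn : n = k + 2 * j + 1) (hj : 1 ≤ j)
    (th : Wn n (M + 1) (M + 2) n → D0 (fjk j k))
    (h : ∀ c, Lam j k 0 (th c) = CA (fa (M + 1)) (fb (M + 1)) (M + 1) n c.1 ∧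
      Lam j k 1 (th c) = CB (fa (M + 1)) (fb (M + 1)) (M + 1) n c.1 ∧
      Lam j k 2 (th c) = um (fa (M + 1)) (fb (M + 1)) (M + 1) c.1 ∧
      IsHomogDer (th c).1 (n + (M + 1)))
    (c : Polynomial ℝ) (hc : c ∈ Wn n M (M + 1) n) :
    fa (M + 1) • th ⟨c, mem_W_of_mem_U hc⟩ - fb (M + 1) • th ⟨Polynomial.X * c, X_mul_mem_W hc⟩
      - (X 2 : S) • th ⟨TopOp M c, TopOp_mem_W hc⟩ = 0 := by
  apply eq_zero_of_Lam2 j k _ (M + 2) (by omega)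
  · intro i
    have hh := fun c => (h c).2.2.2 i
    have e : k + 2 * j + 1 + (M + 2) = 1 + (n + (M + 1)) := by omega
    rw [e]
    exact (((fa_hom _).mul (hh _)).sub ((fb_hom _).mul (hh _))).sub
      ((isHomogeneous_X _ _).mul (hh _))
  · have e := fun θ η : D0 (fjk j k) => map_sub (LamL j k 2) θ η
    change ∀ θ η, Lam j k 2 (θ - η) = Lam j k 2 θ - Lam j k 2 η at e
    rw [e, e, Lam_smul, Lam_smul, Lam_smul, (h _).2.2.1, (h _).2.2.1, (h _).2.2.1,
      um_rel _ _ _ _ (mem_Wn.1 hc).1, sub_self]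
/-! ### Vanishing arguments on the target side -/

lemma algHom_aeval {A : Type*} [CommRing A] [Algebra ℝ A] (ψ : A →ₐ[ℝ] ℝ) (v : Fin 3 → A)
    (G : S) : ψ (aeval v G) = eval (fun i => ψ (v i)) G := by
  induction G using MvPolynomial.induction_on with
  | C r => simp
  | add p q hp hq => simp only [map_add, hp, hq]
  | mul_X p i hp => simp only [map_mul, hp, aeval_X, eval_X]

lemma eval_scale (G : S) (d : ℕ) (hG : G.IsHomogeneous d) (c : ℝ) (p : Fin 3 → ℝ) :
    eval (fun i => c * p i) G = c ^ d * eval p G := by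
  rw [eval_eq', eval_eq', Finset.mul_sum]
  refine Finset.sum_congr rfl fun m hm => ?_
  have hd : ∑ i, m i = d := by
    have := hG (mem_support_iff.1 hm)
    rw [← this, Finsupp.weight_apply, Finsupp.sum_fintype _ _ (by simp)]
    simp
  simp only [mul_pow, Finset.prod_mul_distrib, Finset.prod_pow_eq_pow_sum]
  rw [hd]; ring

lemma totalDegree_aeval2 (G : S) (d : ℕ) (hG : G.IsHomogeneous d)
    (v : Fin 3 → MvPolynomial (Fin 2) ℝ) (hv : ∀ i, (v i).totalDegree ≤ 1) :
    (aeval v G).totalDegree ≤ d := by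
  rw [MvPolynomial.aeval_def, eval₂_eq']
  apply totalDegree_finsetSum_le
  intro m hm
  have hd : ∑ i, m i = d := by
    have := hG (mem_support_iff.1 hm)
    rw [← this, Finsupp.weight_apply, Finsupp.sum_fintype _ _ (by simp)]
    simp
  refine (totalDegree_mul _ _).trans ?_
  rw [MvPolynomial.algebraMap_eq, totalDegree_C, zero_add]
  refine (totalDegree_finsetProd _ _).trans ?_
  rw [← hd]
  refine Finset.sum_le_sum fun i _ => ?_
  refine (totalDegree_pow _ _).trans ?_
  calc m i * (v i).totalDegree ≤ m i * 1 := Nat.mul_le_mul_left _ (hv i)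
    _ = m i := mul_one _

lemma tri (G : S) (d : ℕ) (hG : G.IsHomogeneous d) (N : ℝ)
    (h : ∀ a b : ℕ, a + b ≤ d → eval ![N - a, N - b, 1] G = 0) : G = 0 := by
  set v : Fin 3 → MvPolynomial (Fin 2) ℝ := ![X 0, X 1, 1] with hv
  have hev : ∀ s : Fin 2 → ℝ, eval s (aeval v G) = eval ![s 0, s 1, 1] G := by
    intro s
    have := algHom_aeval (aeval s : MvPolynomial (Fin 2) ℝ →ₐ[ℝ] ℝ) v G
    rw [aeval_eq_eval] at this
    refine this.trans ?_
    congr 2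
    funext i
    fin_cases i <;> simp [hv]
  have hg : aeval v G = 0 := by
    by_contra hne
    obtain ⟨t, ht, htd⟩ := Finset.exists_mem_eq_sup _ (support_nonempty.2 hne)
      (fun s => s.sum fun _ e => e)
    have htd' : (aeval v G).totalDegree = t.degree := htd
    have htle : t 0 + t 1 ≤ d := by
      have h1 := totalDegree_aeval2 G d hG v (by
        intro i; fin_cases i <;> simp [hv])
      rw [htd', Finsupp.degree_eq_sum, Fin.sum_univ_two] at h1
      exact h1
    obtain ⟨s, hs, hs0⟩ := combinatorial_nullstellensatz_exists_eval_nonzero (aeval v G) t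
      (mem_support_iff.1 ht) htd'
      (fun i => (Finset.range (t i + 1)).image fun a : ℕ => N - (a : ℝ)) (by
        intro i
        rw [Finset.card_image_of_injective _ (by
          intro a b hab
          have : (a : ℝ) = b := by simpa using hab
          exact_mod_cast this), Finset.card_range]
        omega)
    obtain ⟨a, ha, ha'⟩ := Finset.mem_image.1 (hs 0)
    obtain ⟨b, hb, hb'⟩ := Finset.mem_image.1 (hs 1)
    rw [Finset.mem_range] at ha hb
    apply hs0
    rw [hev, ← ha', ← hb']
    exact h a b (by omega)
  have hz : X 2 * G = 0 := by
    apply MvPolynomial.funext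
    intro p
    rw [map_mul, eval_X, map_zero]
    by_cases hp : p 2 = 0
    · rw [hp, zero_mul]
    · have e : p = fun i => p 2 * (![p 0 / p 2, p 1 / p 2, 1] : Fin 3 → ℝ) i := by
        funext i
        fin_cases i <;> simp <;> field_simp
      have h2 := hev ![p 0 / p 2, p 1 / p 2]
      rw [hg, map_zero] at h2
      have h3 := eval_scale G d hG (p 2) ![p 0 / p 2, p 1 / p 2, 1]
      rw [← e] at h3
      rw [h3]
      have h4 : eval ![p 0 / p 2, p 1 / p 2, 1] G = 0 := h2.symm
      rw [h4, mul_zero, mul_zero]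
  exact (mul_eq_zero.1 hz).resolve_left (X_ne_zero _)

lemma eval_pr (j k : ℕ) (i : Fin 3) (p : Fin 3 → ℝ) :
    eval p (pr j k i) = ∏ s ∈ II j k, (eval p (LL i) - (s : ℝ) * p 2) := by
  simp [pr, al, map_prod]

lemma grid (j k : ℕ) (θ : D0 (fjk j k)) (s t : ℤ) (hs : s ∈ II j k) (ht : t ∈ II j k)
    (hst : s + t ∉ II j k) : eval ![(s : ℝ), (t : ℝ), 1] (Lam j k 2 θ) = 0 := by
  have h := congrArg (eval ![(s : ℝ), (t : ℝ), 1]) (Lam_syz j k θ)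
  rw [map_add, map_mul, map_mul, map_mul] at h
  have h0 : eval ![(s : ℝ), (t : ℝ), 1] (pr j k 0) = 0 := by
    rw [eval_pr]
    exact Finset.prod_eq_zero hs (by simp [LL])
  have h1 : eval ![(s : ℝ), (t : ℝ), 1] (pr j k 1) = 0 := by
    rw [eval_pr]
    exact Finset.prod_eq_zero ht (by simp [LL])
  have h2 : eval ![(s : ℝ), (t : ℝ), 1] (pr j k 2) ≠ 0 := by
    rw [eval_pr, Finset.prod_ne_zero_iff]
    intro u hu h0
    apply hst
    have : (s : ℝ) + t = u := by
      have := sub_eq_zero.1 h0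
      simpa [LL] using this
    have : s + t = u := by exact_mod_cast this
    rwa [this]
  rw [h0, h1, zero_mul, zero_mul, zero_add] at h
  exact (mul_eq_zero.1 h.symm).resolve_left h2

lemma line_zero (j k N : ℕ) (hN : N = k + j) (θ : D0 (fjk j k))
    (hθ : IsHomogDer θ.1 (k + 2 * j + 1 + N)) (e0 : ℝ) (he0 : e0 ≤ 0)
    (h0 : eval ![N * e0, 1, e0] (Lam j k 2 θ) = 0) (e : ℝ) :
    eval ![N * e, 1, e] (Lam j k 2 θ) = 0 := by
  set G := Lam j k 2 θ with hGdef
  have hG : G.IsHomogeneous N := Lam_hom j k 2 θ N hθ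
  set v : Fin 3 → Polynomial ℝ := ![Polynomial.C (N : ℝ) * Polynomial.X, 1, Polynomial.X] with hv
  have hev : ∀ e : ℝ, (aeval v G).eval e = eval ![N * e, 1, e] G := by
    intro e
    have := algHom_aeval (Polynomial.aeval e : Polynomial ℝ →ₐ[ℝ] ℝ) v G
    rw [Polynomial.coe_aeval_eq_eval] at this
    refine this.trans ?_
    congr 2
    funext i
    fin_cases i <;> simp [hv]
  have hdeg : (aeval v G).natDegree ≤ N := by
    have := aeval_natDegree_le G hG.totalDegree_le v (n := 1) (by
      intro i
      fin_cases i
      · exact (Polynomial.natDegree_C_mul_le _ _).trans (by simp)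
      · simp [hv]
      · simp [hv])
    simpa using this
  have hzero : aeval v G = 0 := by
    have hnot : e0 ∉ (Finset.Icc 1 N).image (fun i : ℕ => ((i : ℝ))⁻¹) := by
      intro hmem
      obtain ⟨i, hi, hi'⟩ := Finset.mem_image.1 hmem
      rw [Finset.mem_Icc] at hi
      have : (0 : ℝ) < (i : ℝ)⁻¹ := by
        have : (0 : ℝ) < i := by exact_mod_cast hi.1
        positivity
      linarith
    apply Polynomial.eq_zero_of_degree_lt_of_eval_finset_eq_zero
      (insert e0 ((Finset.Icc 1 N).image (fun i : ℕ => ((i : ℝ))⁻¹)))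
    · rw [Finset.card_insert_of_notMem hnot, Finset.card_image_of_injective _ (by
        intro a b hab
        have : (a : ℝ) = b := by simpa using hab
        exact_mod_cast this), Nat.card_Icc]
      refine lt_of_le_of_lt Polynomial.degree_le_natDegree ?_
      norm_cast
      omega
    · intro x hx
      rw [hev]
      rcases Finset.mem_insert.1 hx with rfl | hx
      · exact h0
      · obtain ⟨i, hi, rfl⟩ := Finset.mem_image.1 hx
        rw [Finset.mem_Icc] at hi
        have hi0 : (i : ℝ) ≠ 0 := by
          have : i ≠ 0 := by omega
          exact_mod_cast this
        have e : (![N * (i : ℝ)⁻¹, 1, (i : ℝ)⁻¹] : Fin 3 → ℝ) =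
            fun l => (i : ℝ)⁻¹ * (![((N : ℤ) : ℝ), ((i : ℤ) : ℝ), 1] : Fin 3 → ℝ) l := by
          funext l
          fin_cases l <;> simp [hi0, mul_comm]
        rw [e, eval_scale G N hG, grid j k θ, mul_zero]
        · simp only [II, Finset.mem_Icc]; omega
        · simp only [II, Finset.mem_Icc]; omega
        · simp only [II, Finset.mem_Icc]; omega
  rw [← hev, hzero, Polynomial.eval_zero]

/-- restriction to the line at infinity -/
def shp : S →ₐ[ℝ] Polynomial ℝ := aeval ![Polynomial.X, 1, 0]

lemma shp_eval (G : S) (t : ℝ) : (shp G).eval t = eval ![t, 1, 0] G := by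
  have := algHom_aeval (Polynomial.aeval t : Polynomial ℝ →ₐ[ℝ] ℝ)
    ![Polynomial.X, 1, 0] G
  rw [Polynomial.coe_aeval_eq_eval] at this
  refine this.trans ?_
  congr 2
  funext i
  fin_cases i <;> simp

lemma shp_deg (G : S) (N : ℕ) (hG : G.IsHomogeneous N) : (shp G).natDegree ≤ N := by
  have := aeval_natDegree_le G hG.totalDegree_le (![Polynomial.X, 1, 0] : Fin 3 → Polynomial ℝ)
    (n := 1) (by
      intro i
      fin_cases i <;> simp)
  simpa [shp] using this

lemma shp_window (j k N n : ℕ) (hn : n = k + 2 * j + 1) (θ : D0 (fjk j k))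
    (hθ : IsHomogDer θ.1 (k + 2 * j + 1 + N)) (l : ℕ) (h1 : N < l) (h2 : l < n) :
    ec n l (shp (Lam j k 2 θ)) = 0 := by
  have h := congrArg shp (Lam_syz j k θ)
  rw [map_add, map_mul, map_mul, map_mul] at h
  have p0 : shp (pr j k 0) = Polynomial.X ^ n := by
    simp [shp, pr, al, LL, map_prod, card_II, hn]
  have p1 : shp (pr j k 1) = 1 := by
    simp [shp, pr, al, LL, map_prod]
  have p2 : shp (pr j k 2) = (1 + Polynomial.X) ^ n := by
    simp [shp, pr, al, LL, map_prod, card_II, hn, add_comm]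
  rw [p0, p1, p2, one_mul] at h
  rw [ec_apply, ← h, Polynomial.coeff_add, Polynomial.coeff_X_pow_mul', if_neg (by omega), zero_add]
  exact Polynomial.coeff_eq_zero_of_natDegree_lt
    (lt_of_le_of_lt (shp_deg _ N (Lam_hom j k 1 θ N hθ)) h1)

lemma z_dvd_of_shp (G : S) (N : ℕ) (hG : G.IsHomogeneous N) (h : shp G = 0) : X 2 ∣ G := by
  set v : Fin 3 → S := ![X 0, X 1, 0] with hv
  have h1 := dvd_sub_aeval (X 2) v (by intro i; fin_cases i <;> simp [hv]) G
  have h2 : X 1 * aeval v G = 0 := by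
    apply MvPolynomial.funext
    intro p
    rw [map_mul, eval_X, map_zero]
    by_cases hp : p 1 = 0
    · rw [hp, zero_mul]
    · have e1 : eval p (aeval v G) = eval ![p 0, p 1, 0] G := by
        have := algHom_aeval (aeval p : S →ₐ[ℝ] ℝ) v G
        rw [aeval_eq_eval] at this
        refine this.trans ?_
        congr 2
        funext i
        fin_cases i <;> simp [hv]
      have e : (![p 0, p 1, 0] : Fin 3 → ℝ) =
          fun i => p 1 * (![p 0 / p 1, 1, 0] : Fin 3 → ℝ) i := by
        funext i
        fin_cases i <;> simp <;> field_simp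
      rw [e1, e, eval_scale G N hG, ← shp_eval, h, Polynomial.eval_zero, mul_zero, mul_zero]
  have h3 := (mul_eq_zero.1 h2).resolve_left (X_ne_zero _)
  rwa [h3, sub_zero] at h1

lemma target_zero (j k N n : ℕ) (hk : 1 ≤ k) (hN : N = k + j) (hn : n = k + 2 * j + 1)
    (θ : D0 (fjk j k)) (hθ : IsHomogDer θ.1 (k + 2 * j + 1 + N))
    (h0 : eval ![0, 1, 0] (Lam j k 2 θ) = 0)
    (h1 : ∀ i < k, ec n (n + i) (shp (Lam j k 2 θ)) = 0) : θ = 0 := by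
  apply eq_zero_of_Lam2 j k θ N (by omega) hθ
  set G := Lam j k 2 θ with hGdef
  have hG : G.IsHomogeneous N := Lam_hom j k 2 θ N hθ
  have hs : shp G = 0 := by
    obtain ⟨c, hc⟩ : Polynomial.X ∣ shp G := by
      rw [Polynomial.X_dvd_iff, Polynomial.coeff_zero_eq_eval_zero, shp_eval]
      exact h0
    by_contra hne
    have hc0 : c ≠ 0 := by rintro rfl; exact hne (by rw [hc, mul_zero])
    have hd := shp_deg G N hG
    rw [hc, Polynomial.natDegree_X_mul hc0] at hd
    have := window_le n N N (N - 1) c hc0 (by omega) (by omega) (by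
      intro l hl1 hl2
      rw [← ec_X_mul, ← hc]
      by_cases hl : l + 1 < n
      · exact shp_window j k N n hn θ hθ _ (by omega) hl
      · obtain ⟨i, hi⟩ : ∃ i, l + 1 = n + i := ⟨l + 1 - n, by omega⟩
        rw [hi]
        exact h1 i (by omega))
    omega
  obtain ⟨G', hG'⟩ := z_dvd_of_shp G N hG hs
  have hG'h : G'.IsHomogeneous (N - 1) := by
    apply hom_quot (X 2) G' 1 (N - 1) (isHomogeneous_X _ _) (X_ne_zero _)
    rw [← hG']
    convert hG using 1
    omega
  have : G' = 0 := by
    apply tri G' (N - 1) hG'h N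
    intro a b hab
    have h := grid j k θ ((N : ℤ) - a) ((N : ℤ) - b)
      (by simp only [II, Finset.mem_Icc]; omega)
      (by simp only [II, Finset.mem_Icc]; omega)
      (by simp only [II, Finset.mem_Icc]; omega)
    rw [← hGdef, hG', map_mul, eval_X] at h
    push_cast at h
    simpa using h
  rw [hG', this, mul_zero]
/-- Failure of the shift isomorphism for `k ≥ 3`: there is no graded `S`-linear
isomorphism `D_0(f_{j+1,k}) ≅ D_0(f_{j,k})` shifting degrees by the Coxeter number 3,
i.e. `T_A ≇ T_B(3)` for `A = A_{A2}^{[-j,k+j]}`, `B = A_{A2}^{[-j-1,k+j+1]}`. -/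
theorem shift_isomorphism_fails (k j : ℕ) (hk : 3 ≤ k) :
    ¬ ∃ φ : D0 (fjk (j + 1) k) ≃ₗ[S] D0 (fjk j k),
      ∀ d : ℕ, ∀ θ : D0 (fjk (j + 1) k),
        IsHomogDer (θ : Derivation ℝ S S) (d + 3) →
          IsHomogDer ((φ θ : Derivation ℝ S S)) d := by
  rintro ⟨φ, hφ⟩
  obtain ⟨M, hM⟩ : ∃ M, M = k + j := ⟨_, rfl⟩
  obtain ⟨n', hn'⟩ : ∃ n', n' = k + 2 * (j + 1) + 1 := ⟨_, rfl⟩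
  obtain ⟨n, hn⟩ : ∃ n, n = k + 2 * j + 1 := ⟨_, rfl⟩
  obtain ⟨th, hth⟩ : ∃ th : Wn n' (M + 1) (M + 2) n' → D0 (fjk (j + 1) k), ∀ c,
      Lam (j + 1) k 0 (th c) = CA (fa (M + 1)) (fb (M + 1)) (M + 1) n' c.1 ∧
      Lam (j + 1) k 1 (th c) = CB (fa (M + 1)) (fb (M + 1)) (M + 1) n' c.1 ∧
      Lam (j + 1) k 2 (th c) = um (fa (M + 1)) (fb (M + 1)) (M + 1) c.1 ∧
      IsHomogDer (th c).1 (n' + (M + 1)) := exists_th (j + 1) k (M + 1) n' (by omega) hn'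
  obtain ⟨hadd, hsmul, hinj⟩ := source (j + 1) k (M + 1) n' (by omega) hn' th hth
  have hhom : ∀ c, IsHomogDer (φ (th c)).1 (k + 2 * j + 1 + M) := by
    intro c
    apply hφ
    have := (hth c).2.2.2
    rwa [show n' + (M + 1) = k + 2 * j + 1 + M + 3 by omega] at this
  have hrel : ∀ c (hc : c ∈ Wn n' M (M + 1) n'),
      fa (M + 1) * Lam j k 2 (φ (th ⟨c, mem_W_of_mem_U hc⟩))
        - fb (M + 1) * Lam j k 2 (φ (th ⟨Polynomial.X * c, X_mul_mem_W hc⟩))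
        - X 2 * Lam j k 2 (φ (th ⟨TopOp M c, TopOp_mem_W hc⟩)) = 0 := by
    intro c hc
    have h := congrArg (fun x => Lam j k 2 (φ x))
      (source_rel (j + 1) k M n' (by omega) hn' (by omega) th hth c hc)
    have e := fun x y : D0 (fjk j k) => map_sub (LamL j k 2) x y
    change ∀ x y, Lam j k 2 (x - y) = Lam j k 2 x - Lam j k 2 y at e
    have e0 : Lam j k 2 0 = 0 := map_zero (LamL j k 2)
    have e1 := fun x y : D0 (fjk (j + 1) k) => map_sub φ.toLinearMap x y
    change ∀ x y, φ (x - y) = φ x - φ y at e1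
    have e2 := fun (s : S) (x : D0 (fjk (j + 1) k)) => map_smul φ.toLinearMap s x
    change ∀ s x, φ (s • x) = s • φ x at e2
    rw [← Lam_smul, ← Lam_smul, ← Lam_smul, ← e, ← e, ← e2, ← e2, ← e2, ← e1, ← e1]
    exact h.trans (by simp only [map_zero, e0])
  let G : Wn n' (M + 1) (M + 2) n' →ₗ[ℝ] S :=
    { toFun := fun c => Lam j k 2 (φ (th c))
      map_add' := by
        intro c d
        rw [hadd, map_add, Lam_add]
      map_smul' := by
        intro r c
        rw [hsmul, map_smul, Lam_smul, RingHom.id_apply, MvPolynomial.smul_eq_C_mul] }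
  have hGdef : ∀ c, G c = Lam j k 2 (φ (th c)) := fun _ => rfl
  let r : Wn n' (M + 1) (M + 2) n' →ₗ[ℝ] ℝ :=
    (aeval (![0, 1, 0] : Fin 3 → ℝ) : S →ₐ[ℝ] ℝ).toLinearMap.comp G
  have hrdef : ∀ c, r c = eval ![0, 1, 0] (Lam j k 2 (φ (th c))) := by
    intro c
    change (aeval (![0, 1, 0] : Fin 3 → ℝ) : S →ₐ[ℝ] ℝ) (G c) = _
    rw [aeval_eq_eval]; rfl
  have hline : ∀ (e : ℝ) c (hc : c ∈ Wn n' M (M + 1) n'),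
      e * eval ![M * e, 1, e] (Lam j k 2 (φ (th ⟨c, mem_W_of_mem_U hc⟩)))
        - ((M + 1) * e - 1) *
          eval ![M * e, 1, e] (Lam j k 2 (φ (th ⟨Polynomial.X * c, X_mul_mem_W hc⟩)))
        - e * eval ![M * e, 1, e] (Lam j k 2 (φ (th ⟨TopOp M c, TopOp_mem_W hc⟩))) = 0 := by
    intro e c hc
    have h := congrArg (eval ![M * e, 1, e]) (hrel c hc)
    simp only [map_sub, map_mul, map_zero, fa, fb, eval_X, eval_C, Matrix.cons_val_zero,
      Matrix.cons_val_one, Matrix.cons_val] at h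
    push_cast at h
    linear_combination h
  have hr1 : ∀ c (hc : c ∈ Wn n' M (M + 1) n'),
      r ⟨Polynomial.X * c, X_mul_mem_W hc⟩ = 0 := by
    intro c hc
    have h := hline 0 c hc
    rw [hrdef]
    simpa using h
  have hr2 : ∀ c (hc : c ∈ Wn n' M (M + 1) n'),
      r ⟨c, mem_W_of_mem_U hc⟩ = r ⟨TopOp M c, TopOp_mem_W hc⟩ := by
    intro c hc
    have hX : eval ![M * (-1 : ℝ), 1, -1]
        (Lam j k 2 (φ (th ⟨Polynomial.X * c, X_mul_mem_W hc⟩))) = 0 := by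
      apply line_zero j k M hM _ (hhom _) 0 le_rfl
      have := hr1 c hc
      rw [hrdef] at this
      simpa using this
    have h := hline (-1) c hc
    rw [hX] at h
    have hsub : ∀ p : Fin 3 → ℝ, eval p (Lam j k 2 (φ (th ⟨c, mem_W_of_mem_U hc⟩) -
        φ (th ⟨TopOp M c, TopOp_mem_W hc⟩))) =
        eval p (Lam j k 2 (φ (th ⟨c, mem_W_of_mem_U hc⟩))) -
        eval p (Lam j k 2 (φ (th ⟨TopOp M c, TopOp_mem_W hc⟩))) := by
      intro p
      rw [← map_sub]
      exact congrArg (eval p) (map_sub (LamL j k 2) _ _)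
    have h0 := line_zero j k M hM
      (φ (th ⟨c, mem_W_of_mem_U hc⟩) - φ (th ⟨TopOp M c, TopOp_mem_W hc⟩))
      (fun i => (hhom _ i).sub (hhom _ i)) (-1) (by norm_num)
      (by rw [hsub]; linear_combination -h) 0
    rw [hsub, mul_zero] at h0
    rw [hrdef, hrdef]
    linear_combination h0
  have hr : r = 0 := functional_zero n' M (j + 1) (by omega) (by omega) r hr1 hr2
  let ψ : Wn n' (M + 1) (M + 2) n' →ₗ[ℝ] (Fin k → ℝ) :=
    LinearMap.pi fun i : Fin k => (ec n (n + i)).comp (shp.toLinearMap.comp G)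
  have hψ : Function.Injective ψ := by
    rw [injective_iff_map_eq_zero]
    intro c hc
    apply hinj
    apply φ.injective
    rw [map_zero]
    apply target_zero j k M n (by omega) hM hn _ (hhom c)
    · rw [← hrdef, hr]; rfl
    · intro i hi
      exact congrFun hc ⟨i, hi⟩
  have h1 := LinearMap.finrank_le_finrank_of_injective hψ
  rw [Module.finrank_fin_fun] at h1
  have h2 := finrank_Wn n' (M + 1) (M + 2) (j + 1)
  rw [show M + 2 + (j + 1) = n' by omega] at h2
  omega
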